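/- Let Q be a commutative ring, let g : X → Y be a quasi-isomorphism of Z-indexed chain complexes of Q-modules, and let f : F → X be a chain map where F is a bounded below complex of projective Q-modules. Suppose g ∘ f is null-homotopic with null-homotopy s (a family s_n : F_n → Y_{n+1} with g f = ∂^Y s + s ∂^F). Then there exists a family of maps h_n : F_n → X_{n+1} such that f = ∂^X h + h ∂^F (so h is a null-homotopy of f), and such that the family of maps (s_n - g_{n+1} ∘ h_n : F_n → Y_{n+1}), which constitutes a chain map from the shift ΣF to Y, is itself null-homotopic; i.e. there is a family t_n : F_n → Y_{n+2} with s - g h = ∂^Y t - t ∂^F. -/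

import Mathlib

open CategoryTheory

/-- A dependent function on `ℤ` can be constructed by recursion from a starting point `N`, subject
to constraints `P n` that only involve its values up to `n`. -/
theorem Int.exists_pi_of_forall_exists_update {β : ℤ → Type*} (P : ℤ → (∀ k, β k) → Prop)
    (hP : ∀ n p q, (∀ k ≤ n, p k = q k) → P n p → P n q)
    (N : ℤ) (p₀ : ∀ k, β k) (h₀ : ∀ n < N, P n p₀)
    (step : ∀ n p, (∀ k < n, P k p) → ∃ x, P n (Function.update p n x)) :
    ∃ p, ∀ n, P n p := by
  have step' (m : ℕ) (p : {p : ∀ k, β k // ∀ k < N + m, P k p}) :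
      ∃ q : {q : ∀ k, β k // ∀ k < N + (m + 1 : ℕ), P k q}, ∀ k < N + m, q.1 k = p.1 k := by
    obtain ⟨x, hx⟩ := step _ p.1 p.2
    have agree (k : ℤ) (hk : k < N + m) : Function.update p.1 (N + m) x k = p.1 k :=
      Function.update_of_ne hk.ne _ _
    refine ⟨⟨Function.update p.1 (N + m) x, fun k hk ↦ ?_⟩, agree⟩
    obtain hk' | rfl : k < N + m ∨ k = N + m := by push_cast at hk; omega
    · exact hP k p.1 _ (fun l hl ↦ (agree l (by omega)).symm) (p.2 k hk')
    · exact hx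
  choose next hnext using step'
  let S (m : ℕ) : {p : ∀ k, β k // ∀ k < N + m, P k p} :=
    Nat.rec ⟨p₀, by simpa using h₀⟩ next m
  have hS (m l : ℕ) (hml : m ≤ l) (k : ℤ) (hk : k < N + m) : (S l).1 k = (S m).1 k := by
    induction l, hml using Nat.le_induction with
    | base => rfl
    | succ l hl ih => exact (hnext l (S l) k (by omega)).trans ih
  refine ⟨fun k ↦ (S (k + 1 - N).toNat).1 k, fun n ↦
    hP n (S (n + 1 - N).toNat).1 _ (fun k hk ↦ ?_) ((S _).2 n (by omega))⟩
  exact hS _ _ (by omega) k (by omega)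

namespace ChainComplex

variable {C : Type*} [Category* C] [Abelian C] {F X Y : ChainComplex C ℤ}

/-- A morphism from a projective object to the cycles of the mapping cone of a quasi-isomorphism
lifts along the differential of the mapping cone. -/
theorem exists_lift_of_quasiIso (g : X ⟶ Y) [QuasiIso g] {P : C} [Projective P]
    {i j k l : ℤ} (hij : i + 1 = j) (hjk : j + 1 = k) (hkl : k + 1 = l)
    (a : P ⟶ X.X j) (b : P ⟶ Y.X k) (ha : a ≫ X.d j i = 0) (hab : a ≫ g.f j = b ≫ Y.d k j) :
    ∃ (u : P ⟶ X.X k) (v : P ⟶ Y.X l),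
      u ≫ X.d k j = a ∧ u ≫ g.f k + v ≫ Y.d l k = b := by
  obtain ⟨A, π, _, x, hx⟩ := (HomologicalComplex.mono_homologyMap_iff_up_to_refinements
    (φ := g) k j i ((ComplexShape.down ℤ).prev_eq' hjk) ((ComplexShape.down ℤ).next_eq' hij)).1
    inferInstance a ha b hab
  obtain ⟨x', hx'⟩ : ∃ x' : P ⟶ X.X k, x' ≫ X.d k j = a :=
    ⟨Projective.factorThru (𝟙 P) π ≫ x, by
      rw [Category.assoc, ← hx, Projective.factorThru_comp_assoc, Category.id_comp]⟩
  obtain ⟨B, ρ, _, z, hz, y, hy⟩ := (HomologicalComplex.epi_homologyMap_iff_up_to_refinements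
    (φ := g) l k j ((ComplexShape.down ℤ).prev_eq' hkl) ((ComplexShape.down ℤ).next_eq' hjk)).1
    inferInstance (b - x' ≫ g.f k)
    (by rw [Preadditive.sub_comp, Category.assoc, g.comm, reassoc_of% hx', hab, sub_self])
  let σ := Projective.factorThru (𝟙 P) ρ
  have hσ : σ ≫ ρ = 𝟙 P := Projective.factorThru_comp _ _
  refine ⟨x' + σ ≫ z, σ ≫ y, ?_, ?_⟩
  · rw [Preadditive.add_comp, hx', Category.assoc, hz, Limits.comp_zero, add_zero]
  · have := σ ≫= hy
    rw [reassoc_of% hσ, Preadditive.comp_add] at this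
    rw [Preadditive.add_comp, Category.assoc, Category.assoc, add_assoc, ← this,
      add_sub_cancel]

/-- Null-homotopies of maps out of a bounded below complex of projective objects lift along
quasi-isomorphisms, up to a homotopy of null-homotopies. -/
theorem exists_homotopy_of_quasiIso (g : X ⟶ Y) [QuasiIso g] (f : F ⟶ X)
    [∀ i, Projective (F.X i)] (N : ℤ) (hF : ∀ i < N, Limits.IsZero (F.X i))
    (s : Homotopy (f ≫ g) 0) :
    ∃ (h : Homotopy f 0) (t : ∀ i j : ℤ, F.X i ⟶ Y.X j),
      ∀ n : ℤ, s.hom n (n + 1) - h.hom n (n + 1) ≫ g.f (n + 1) =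
        t n (n + 2) ≫ Y.d (n + 2) (n + 1) - F.d n (n - 1) ≫ t (n - 1) (n + 1) := by
  have hs (a n b : ℤ) (ha : a + 1 = n) (hb : n + 1 = b) :
      f.f n ≫ g.f n = F.d n a ≫ s.hom a n + s.hom n b ≫ Y.d b n := by
    have := s.comm n
    rwa [dNext_eq _ (show (ComplexShape.down ℤ).Rel n a from ha),
      prevD_eq _ (show (ComplexShape.down ℤ).Rel b n from hb),
      HomologicalComplex.zero_f, add_zero, HomologicalComplex.comp_f] at this
  obtain ⟨p, hp⟩ := Int.exists_pi_of_forall_exists_update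
    (β := fun n ↦ (∀ j, F.X n ⟶ X.X j) × (∀ j, F.X n ⟶ Y.X j))
    (fun n p ↦ ∀ a b c : ℤ, a + 1 = n → n + 1 = b → b + 1 = c →
      (p n).1 b ≫ X.d b n = f.f n - F.d n a ≫ (p a).1 n ∧
      (p n).1 b ≫ g.f b + (p n).2 c ≫ Y.d c b = s.hom n b + F.d n a ≫ (p a).2 b)
    (fun n p q hpq hp a b c ha hb hc ↦ by
      rw [← hpq n le_rfl, ← hpq a (by omega)]
      exact hp a b c ha hb hc)
    N (fun _ ↦ 0)
    (fun n hn a b c _ _ _ ↦ ⟨(hF n hn).eq_of_src _ _, (hF n hn).eq_of_src _ _⟩)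
    (fun n p hp ↦ by
      obtain ⟨h₁, h₂⟩ := hp (n - 1) (by omega) (n - 2) n (n + 1) (by omega) (by omega) rfl
      obtain ⟨u, v, hu, hv⟩ := exists_lift_of_quasiIso g (P := F.X n) (i := n - 1) (j := n)
        (k := n + 1) (l := n + 2) (by omega) rfl (by omega)
        (f.f n - F.d n (n - 1) ≫ (p (n - 1)).1 n)
        (s.hom n (n + 1) + F.d n (n - 1) ≫ (p (n - 1)).2 (n + 1))
        (by simp [h₁])
        (by
          have h₃ : (p (n - 1)).2 (n + 1) ≫ Y.d (n + 1) n =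
              s.hom (n - 1) n + F.d (n - 1) (n - 2) ≫ (p (n - 2)).2 n -
                (p (n - 1)).1 n ≫ g.f n := eq_sub_of_add_eq' h₂
          simp [hs (n - 1) n (n + 1) (by omega) rfl, h₃]
          abel)
      refine ⟨(Function.update 0 (n + 1) u, Function.update 0 (n + 2) v), ?_⟩
      intro a b c ha hb hc
      obtain rfl : a = n - 1 := by omega
      obtain rfl : b = n + 1 := by omega
      obtain rfl : c = n + 2 := by omega
      have hne : n - 1 ≠ n := by omega
      simpa [Function.update_of_ne hne] using And.intro hu hv)
  refine ⟨{ hom := fun i j ↦ if i + 1 = j then (p i).1 j else 0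
            zero := fun i j hij ↦ if_neg hij
            comm := fun n ↦ ?_ }, fun i j ↦ (p i).2 j, fun n ↦ ?_⟩
  · rw [dNext_eq _ (show (ComplexShape.down ℤ).Rel n (n - 1) from by simp),
      prevD_eq _ (show (ComplexShape.down ℤ).Rel (n + 1) n from rfl)]
    have := (hp n (n - 1) (n + 1) (n + 2) (by omega) rfl (by omega)).1
    simp [this]
  · have := (hp n (n - 1) (n + 1) (n + 2) (by omega) rfl (by omega)).2
    simp only [if_true]
    rw [sub_eq_sub_iff_add_eq_add, ← this]
    exact add_comm _ _

end ChainComplex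

/-- **Null-homotopies lift along quasi-isomorphisms.**
Let `g : X ⟶ Y` be a quasi-isomorphism of `ℤ`-indexed chain complexes of
`Q`-modules and `f : F ⟶ X` a chain map, where `F` is a bounded below complex
of projective modules.  If `g ∘ f` is null-homotopic with null-homotopy `s`,
then `f` is null-homotopic, via a null-homotopy `h` which can be chosen so
that the degree `+1` family `s - g ∘ h` (a chain map `ΣF ⟶ Y`) is itself
null-homotopic: there is a degree `+2` family `t` with
`s - g h = ∂^Y t - t ∂^F`. -/
theorem null_homotopic_qi {Q : Type*} [CommRing Q]
    {F X Y : ChainComplex (ModuleCat Q) ℤ}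
    (g : X ⟶ Y) (hqis : QuasiIso g) (f : F ⟶ X)
    (hproj : ∀ i : ℤ, Module.Projective Q (F.X i))
    (hbdd : ∃ N : ℤ, ∀ i < N, Subsingleton (F.X i))
    (s : Homotopy (f ≫ g) 0) :
    ∃ h : Homotopy f 0, ∃ t : ∀ i j : ℤ, F.X i ⟶ Y.X j,
      ∀ n : ℤ, s.hom n (n + 1) - h.hom n (n + 1) ≫ g.f (n + 1) =
        t n (n + 2) ≫ Y.d (n + 2) (n + 1) - F.d n (n - 1) ≫ t (n - 1) (n + 1) := by
  obtain ⟨N, hN⟩ := hbdd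
  exact ChainComplex.exists_homotopy_of_quasiIso g f N
    (fun i hi ↦ have := hN i hi; ModuleCat.isZero_of_subsingleton _) s
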